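/- (Necessity of the KKT conditions, eq. (35).) Let H be an n_R×n_T complex matrix, let P_1,…,P_{n_T} > 0 and P_tot > 0. If Q* is feasible and maximizes the mutual information I(Q) = log det(I_{n_R} + H Q Hᴴ) over all feasible Q, then there exist a real λ ≥ 0, an n_T×n_T real diagonal matrix Λ with nonnegative diagonal entries, and an n_T×n_T Hermitian positive semidefinite matrix M such that: Hᴴ(I_{n_R} + H Q* Hᴴ)⁻¹H = λ·I_{n_T} + Λ − M, M·Q* = 0, Λ_{ii}·((Q*)_{ii} − P_i) = 0 for every i, and λ·(trace(Q*) − P_tot) = 0. -/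

import Mathlib

open Matrix
open scoped ComplexOrder

/-- A covariance matrix `Q` is feasible for per-antenna limits `P` and total limit `Ptot`
if it is Hermitian positive semidefinite, its diagonal entries are bounded by `P`,
and its trace is bounded by `Ptot`. -/
def Feasible {nT : ℕ} (P : Fin nT → ℝ) (Ptot : ℝ) (Q : Matrix (Fin nT) (Fin nT) ℂ) : Prop :=
  Q.PosSemidef ∧ (∀ i, (Q i i).re ≤ P i) ∧ Q.trace.re ≤ Ptot

/-- Mutual information `I(Q) = log det(I + H Q Hᴴ)`; the determinant is a positive real
number, so we take its real part. -/
noncomputable def mutualInfo {nR nT : ℕ} (H : Matrix (Fin nR) (Fin nT) ℂ)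
    (Q : Matrix (Fin nT) (Fin nT) ℂ) : ℝ :=
  Real.log ((1 + H * Q * Hᴴ).det.re)

/-- Fan's theorem of the alternative: a finite family of convex functions on a convex set which is
nowhere simultaneously negative has a nontrivial nonnegative combination that is nonnegative. -/
theorem exists_nonneg_combination_nonneg {κ E : Type*} [Fintype κ] [AddCommGroup E] [Module ℝ E]
    {K : Set E} (hne : K.Nonempty) {F : κ → E → ℝ} (hF : ∀ k, ConvexOn ℝ K (F k)) (hK : Convex ℝ K)
    (hneg : ∀ x ∈ K, ∃ k, 0 ≤ F k x) :
    ∃ y : κ → ℝ, (∀ k, 0 ≤ y k) ∧ y ≠ 0 ∧ ∀ x ∈ K, 0 ≤ ∑ k, y k * F k x := by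
  classical
  set S : Set (κ → ℝ) := {w | ∃ x ∈ K, ∀ k, F k x < w k} with hS
  have hSconv : Convex ℝ S := by
    rintro w ⟨x, hx, hxw⟩ z ⟨x', hx', hxz⟩ a b ha hb hab
    refine ⟨a • x + b • x', hK hx hx' ha hb hab, fun k => ((hF k).2 hx hx' ha hb hab).trans_lt ?_⟩
    simp only [Pi.add_apply, Pi.smul_apply, smul_eq_mul]
    rcases ha.eq_or_lt with rfl | ha'
    · have : b = 1 := by linarith
      subst this
      simpa using hxz k
    · exact add_lt_add_of_lt_of_le (mul_lt_mul_of_pos_left (hxw k) ha')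
        (mul_le_mul_of_nonneg_left (hxz k).le hb)
  have hSopen : IsOpen S := by
    have : S = ⋃ x ∈ K, ⋂ k, {w : κ → ℝ | F k x < w k} := by
      ext w
      simp [hS]
    rw [this]
    exact isOpen_biUnion fun x _ => isOpen_iInter_of_finite fun k =>
      isOpen_lt continuous_const (continuous_apply k)
  have h0 : (0 : κ → ℝ) ∉ S := by
    rintro ⟨x, hx, hlt⟩
    obtain ⟨k, hk⟩ := hneg x hx
    exact absurd (hlt k) (not_lt.2 hk)
  obtain ⟨f, hf⟩ := geometric_hahn_banach_point_open hSconv hSopen h0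
  rw [map_zero] at hf
  set y : κ → ℝ := fun k => f (Pi.single k 1) with hy
  have hfy : ∀ w, f w = ∑ k, y k * w k := fun w => by
    rw [← ContinuousLinearMap.coe_coe, LinearMap.pi_apply_eq_sum_univ]
    refine Finset.sum_congr rfl fun k _ => ?_
    have hsingle : (fun j => if k = j then 1 else 0) = (Pi.single k 1 : κ → ℝ) := by
      ext j
      simp [Pi.single_apply, eq_comm]
    rw [smul_eq_mul, mul_comm, hy, hsingle, ContinuousLinearMap.coe_coe]
  have hmem : ∀ x ∈ K, ∀ ε > 0, (fun k => F k x + ε) ∈ S := fun x hx ε hε =>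
    ⟨x, hx, fun k => lt_add_of_pos_right _ hε⟩
  obtain ⟨x₀, hx₀⟩ := hne
  refine ⟨y, fun k => ?_, ?_, fun x hx => ?_⟩
  · by_contra! hk
    set w : κ → ℝ := fun k => F k x₀ + 1
    have hw : 0 < f w := hf _ (hmem x₀ hx₀ 1 one_pos)
    have ht : 0 ≤ f w / -y k := by
      have : 0 < -y k := by linarith
      positivity
    have hmem' : w + (f w / -y k) • Pi.single k 1 ∈ S := by
      refine ⟨x₀, hx₀, fun j => ?_⟩
      have h1 : 0 ≤ (Pi.single k 1 : κ → ℝ) j := by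
        rw [Pi.single_apply]; split_ifs <;> norm_num
      have h2 := mul_nonneg ht h1
      simp only [w, Pi.add_apply, Pi.smul_apply, smul_eq_mul] at h2 ⊢
      linarith
    have h := hf _ hmem'
    rw [map_add, map_smul, smul_eq_mul] at h
    change 0 < f w + f w / -y k * y k at h
    have : f w / -y k * y k = -f w := by
      rw [div_neg, neg_mul, div_mul_cancel₀ _ hk.ne]
    linarith
  · intro h
    have := hf _ (hmem x₀ hx₀ 1 one_pos)
    simp [hfy, h] at this
  · have hlim : Filter.Tendsto (fun ε : ℝ => ∑ k, y k * (F k x + ε)) (nhdsWithin 0 (Set.Ioi 0))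
        (nhds (∑ k, y k * (F k x + 0))) :=
      (Continuous.tendsto (by fun_prop) 0).mono_left nhdsWithin_le_nhds
    have := ge_of_tendsto hlim (Filter.eventually_of_mem self_mem_nhdsWithin fun ε hε =>
      (hfy _ ▸ hf _ (hmem x hx ε hε)).le)
    simpa using this

/-- Strong duality for a conic linear program with strictly positive right-hand sides. -/
theorem exists_multipliers_of_isMaxOn {ι E : Type*} [Fintype ι] [AddCommGroup E] [Module ℝ E]
    (K : PointedCone ℝ E) (φ : E →ₗ[ℝ] ℝ) (g : ι → E →ₗ[ℝ] ℝ) {c : ι → ℝ} (hc : ∀ i, 0 < c i)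
    {v : ℝ} (hmax : ∀ x ∈ K, (∀ i, g i x ≤ c i) → φ x ≤ v) :
    ∃ y : ι → ℝ, (∀ i, 0 ≤ y i) ∧ (∀ x ∈ K, φ x ≤ ∑ i, y i * g i x) ∧ ∑ i, y i * c i ≤ v := by
  have hK : Convex ℝ (K : Set E) := K.convex
  obtain ⟨z, hz, hz0, hzK⟩ := exists_nonneg_combination_nonneg (K := (K : Set E)) ⟨0, K.zero_mem⟩
    (F := fun k : Option ι => k.elim (fun x => v - φ x) (fun i x => g i x - c i))
    (by
      rintro (_ | i)
      · exact (convexOn_const v hK).sub (φ.concaveOn hK)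
      · exact ((g i).convexOn hK).sub (concaveOn_const (c i) hK))
    hK
    (by
      intro x hx
      by_contra! h
      have h1 := h none
      have h2 := hmax x hx fun i => by
        have := h (some i)
        simp only [Option.elim] at this
        linarith
      simp only [Option.elim] at h1
      linarith)
  simp only [Fintype.sum_option, Option.elim] at hzK
  have hzero := hzK 0 K.zero_mem
  simp only [map_zero, sub_zero, zero_sub, mul_neg, Finset.sum_neg_distrib] at hzero
  have hpos : 0 < z none := by
    refine (hz none).lt_of_ne fun h => hz0 ?_
    have hnn : ∀ i ∈ Finset.univ, 0 ≤ z (some i) * c i := fun i _ =>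
      mul_nonneg (hz _) (hc i).le
    rw [← h] at hzero
    have hs := (Finset.sum_eq_zero_iff_of_nonneg hnn).1
      (le_antisymm (by linarith) (Finset.sum_nonneg hnn))
    funext k
    rcases k with _ | i
    · exact h.symm
    · simpa [(hc i).ne'] using hs i (Finset.mem_univ i)
  have hdiv : ∀ u : ι → ℝ, ∑ i, z (some i) / z none * u i = (∑ i, z (some i) * u i) / z none :=
    fun u => by
      rw [Finset.sum_div]
      exact Finset.sum_congr rfl fun i _ => by ring
  refine ⟨fun i => z (some i) / z none, fun i => div_nonneg (hz _) (hz _), fun x hx => ?_, ?_⟩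
  · rw [hdiv, le_div_iff₀ hpos]
    by_contra! hlt
    set a := ∑ i, z (some i) * g i x
    set b := ∑ i, z (some i) * c i
    set t := z none * v / (φ x * z none - a) + 1 with ht
    have hd : 0 < φ x * z none - a := by linarith
    have hv : 0 ≤ v := by simpa using hmax 0 K.zero_mem fun i => by simpa using (hc i).le
    have ht0 : 0 ≤ t := by positivity
    have hb : 0 ≤ b := Finset.sum_nonneg fun i _ => mul_nonneg (hz _) (hc i).le
    have h := hzK _ (K.smul_mem ht0 hx)
    simp only [map_smul, smul_eq_mul, mul_sub, Finset.sum_sub_distrib, mul_left_comm _ t,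
      ← Finset.mul_sum] at h
    have htd : t * (φ x * z none - a) = z none * v + (φ x * z none - a) := by
      rw [ht, add_mul, div_mul_cancel₀ _ hd.ne', one_mul]
    change 0 ≤ z none * v - t * (z none * φ x) + (t * a - b) at h
    nlinarith
  · rw [hdiv, div_le_iff₀ hpos]
    linarith

/-- The cone of positive semidefinite complex matrices. -/
def posSemidefCone (n : Type*) : PointedCone ℝ (Matrix n n ℂ) where
  carrier := {Q | Q.PosSemidef}
  add_mem' := Matrix.PosSemidef.add
  zero_mem' := Matrix.PosSemidef.zero
  smul_mem' := fun t _ hQ => hQ.smul t.2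

/-- The real-linear functional `Q ↦ Re tr (A Q)`. -/
def reTraceMul {n : Type*} [Fintype n] (A : Matrix n n ℂ) : Matrix n n ℂ →ₗ[ℝ] ℝ where
  toFun Q := (A * Q).trace.re
  map_add' Q R := by simp [Matrix.mul_add]
  map_smul' t Q := by simp

theorem reTraceMul_apply {n : Type*} [Fintype n] (A Q : Matrix n n ℂ) :
    reTraceMul A Q = (A * Q).trace.re := rfl

open scoped MatrixOrder in
theorem Matrix.PosSemidef.mul_eq_zero_of_trace_mul_eq_zero {n : Type*} [Fintype n]
    {A B : Matrix n n ℂ} (hA : A.PosSemidef) (hB : B.PosSemidef) (h : (A * B).trace = 0) :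
    A * B = 0 := by
  classical
  obtain ⟨C, rfl⟩ := CStarAlgebra.nonneg_iff_eq_star_mul_self.1 hA.nonneg
  obtain ⟨D, rfl⟩ := CStarAlgebra.nonneg_iff_eq_star_mul_self.1 hB.nonneg
  simp only [star_eq_conjTranspose] at h ⊢
  have hCD : C * Dᴴ = 0 := by
    rw [← Matrix.trace_conjTranspose_mul_self_eq_zero_iff, Matrix.conjTranspose_mul,
      Matrix.conjTranspose_conjTranspose, ← h, Matrix.mul_assoc, Matrix.trace_mul_comm]
    simp only [Matrix.mul_assoc]
  rw [Matrix.mul_assoc, ← Matrix.mul_assoc C, hCD, Matrix.zero_mul, Matrix.mul_zero]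

theorem Matrix.posSemidef_of_re_trace_mul_nonneg {n : Type*} [Fintype n] {A : Matrix n n ℂ}
    (hA : A.IsHermitian) (h : ∀ Q : Matrix n n ℂ, Q.PosSemidef → 0 ≤ (A * Q).trace.re) :
    A.PosSemidef := by
  refine .of_dotProduct_mulVec_nonneg hA fun x => ?_
  have hx := h _ (Matrix.posSemidef_vecMulVec_self_star x)
  rw [Matrix.mul_vecMulVec, Matrix.trace_vecMulVec, dotProduct_comm] at hx
  exact Complex.nonneg_iff.2 ⟨hx, (hA.im_star_dotProduct_mulVec_self x).symm⟩

/-- The determinant increases along a direction of positive logarithmic derivative. -/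
theorem Matrix.eventually_det_re_lt_of_re_trace_pos {n : Type*} [Fintype n] [DecidableEq n]
    {A B : Matrix n n ℂ} (hA : A.PosDef) (h : 0 < (A⁻¹ * B).trace.re) :
    ∀ᶠ t : ℝ in nhdsWithin 0 (Set.Ioi 0), A.det.re < (A + (t : ℂ) • B).det.re := by
  obtain ⟨hre, him⟩ := Complex.pos_iff.1 hA.det_pos
  set p := (det (1 + (Polynomial.X : Polynomial ℂ) • (A⁻¹ * B).map Polynomial.C)).divX.divX with hp
  have hdet : ∀ t : ℝ, (A + (t : ℂ) • B).det.re =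
      A.det.re * (1 + t * ((A⁻¹ * B).trace + p.eval (t : ℂ) * t).re) := fun t => by
    have hfac : A + (t : ℂ) • B = A * (1 + (t : ℂ) • (A⁻¹ * B)) := by
      rw [Matrix.mul_add, Matrix.mul_one, Matrix.mul_smul, Matrix.mul_nonsing_inv_cancel_left]
      exact hA.det_pos.ne'.isUnit
    have hexp : 1 + (A⁻¹ * B).trace * (t : ℂ) + p.eval (t : ℂ) * (t : ℂ) ^ 2 =
        1 + (t : ℂ) * ((A⁻¹ * B).trace + p.eval (t : ℂ) * t) := by ring
    rw [hfac, Matrix.det_mul, Matrix.det_one_add_smul, ← hp, hexp, Complex.mul_re, ← him, zero_mul,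
      sub_zero, Complex.add_re, Complex.re_ofReal_mul, Complex.one_re]
  have hcont : Continuous fun t : ℝ => ((A⁻¹ * B).trace + p.eval (t : ℂ) * t).re := by
    fun_prop
  have hev : ∀ᶠ t : ℝ in nhds 0, 0 < ((A⁻¹ * B).trace + p.eval (t : ℂ) * t).re :=
    hcont.continuousAt.eventually_const_lt (by simpa using h)
  filter_upwards [nhdsWithin_le_nhds hev, self_mem_nhdsWithin] with t ht ht0
  rw [hdet]
  have := mul_pos hre (mul_pos (Set.mem_Ioi.1 ht0) ht)
  linarith

theorem Matrix.PosSemidef.posDef_one_add_mul_mul_conjTranspose {m n : Type*} [Fintype m] [Fintype n]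
    [DecidableEq m] {Q : Matrix n n ℂ} (hQ : Q.PosSemidef) (H : Matrix m n ℂ) :
    (1 + H * Q * Hᴴ).PosDef :=
  Matrix.PosDef.one.add_posSemidef (hQ.mul_mul_conjTranspose_same H)

theorem Feasible.add_smul_sub {nT : ℕ} {P : Fin nT → ℝ} {Ptot : ℝ} {Q R : Matrix (Fin nT) (Fin nT) ℂ}
    (hQ : Feasible P Ptot Q) (hR : Feasible P Ptot R) {t : ℝ} (h0 : 0 ≤ t) (h1 : t ≤ 1) :
    Feasible P Ptot (Q + (t : ℂ) • (R - Q)) := by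
  have heq : Q + (t : ℂ) • (R - Q) = (1 - t) • Q + t • R := by
    ext i j
    simp
    ring
  rw [heq]
  refine ⟨(hQ.1.smul (sub_nonneg.2 h1)).add (hR.1.smul h0), fun i => ?_, ?_⟩
  · simp only [Matrix.add_apply, Matrix.smul_apply, Complex.add_re, Complex.real_smul,
      Complex.re_ofReal_mul]
    nlinarith [hQ.2.1 i, hR.2.1 i]
  · simp only [Matrix.trace_add, Matrix.trace_smul, Complex.add_re, Complex.real_smul,
      Complex.re_ofReal_mul]
    nlinarith [hQ.2.2, hR.2.2]

/-- First-order optimality: a maximizer of the mutual information maximizes the linearization of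
the mutual information at itself. -/
theorem re_trace_gradient_mul_le_of_isMax {nR nT : ℕ} {H : Matrix (Fin nR) (Fin nT) ℂ}
    {P : Fin nT → ℝ} {Ptot : ℝ} {Qopt : Matrix (Fin nT) (Fin nT) ℂ} (hfeas : Feasible P Ptot Qopt)
    (hopt : ∀ Q, Feasible P Ptot Q → mutualInfo H Q ≤ mutualInfo H Qopt)
    {Q : Matrix (Fin nT) (Fin nT) ℂ} (hQ : Feasible P Ptot Q) :
    (Hᴴ * (1 + H * Qopt * Hᴴ)⁻¹ * H * Q).trace.re ≤
      (Hᴴ * (1 + H * Qopt * Hᴴ)⁻¹ * H * Qopt).trace.re := by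
  set A := 1 + H * Qopt * Hᴴ with hAdef
  have hA : A.PosDef := hfeas.1.posDef_one_add_mul_mul_conjTranspose H
  by_contra! hlt
  have htr : 0 < (A⁻¹ * (H * (Q - Qopt) * Hᴴ)).trace.re := by
    have : (A⁻¹ * (H * (Q - Qopt) * Hᴴ)).trace = (Hᴴ * A⁻¹ * H * (Q - Qopt)).trace := by
      rw [← Matrix.mul_assoc, Matrix.trace_mul_comm]
      simp only [Matrix.mul_assoc]
    rw [this, Matrix.mul_sub, Matrix.trace_sub, Complex.sub_re]
    linarith
  have hsmall : ∀ᶠ t : ℝ in nhdsWithin 0 (Set.Ioi 0), t ≤ 1 :=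
    nhdsWithin_le_nhds (Iic_mem_nhds one_pos)
  obtain ⟨t, ht, ht1, ht0⟩ := ((Matrix.eventually_det_re_lt_of_re_trace_pos hA htr).and
    (hsmall.and self_mem_nhdsWithin)).exists
  refine absurd (hopt _ (hfeas.add_smul_sub hQ (Set.mem_Ioi.1 ht0).le ht1)) (not_le.2 ?_)
  refine Real.log_lt_log (Complex.pos_iff.1 hA.det_pos).1 ?_
  convert ht using 3
  rw [hAdef, Matrix.mul_add, Matrix.add_mul, ← add_assoc, Matrix.mul_smul, Matrix.smul_mul]

/-- Necessity of the KKT conditions (eq. (35)): at an optimum `Q*` there exist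
multipliers `λ ≥ 0`, diagonal `Λ ≥ 0` and Hermitian PSD `M` satisfying stationarity and
complementary slackness. -/
theorem stmt_12 (nR nT : ℕ) (H : Matrix (Fin nR) (Fin nT) ℂ)
    (P : Fin nT → ℝ) (hP : ∀ i, 0 < P i) (Ptot : ℝ) (hPtot : 0 < Ptot)
    (Qopt : Matrix (Fin nT) (Fin nT) ℂ) (hfeas : Feasible P Ptot Qopt)
    (hopt : ∀ Q, Feasible P Ptot Q → mutualInfo H Q ≤ mutualInfo H Qopt) :
    ∃ (lam : ℝ) (L : Fin nT → ℝ) (M : Matrix (Fin nT) (Fin nT) ℂ),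
      0 ≤ lam ∧ (∀ i, 0 ≤ L i) ∧ M.PosSemidef ∧
      Hᴴ * (1 + H * Qopt * Hᴴ)⁻¹ * H =
        (lam : ℂ) • (1 : Matrix (Fin nT) (Fin nT) ℂ) +
          Matrix.diagonal (fun i => (L i : ℂ)) - M ∧
      M * Qopt = 0 ∧
      (∀ i, L i * ((Qopt i i).re - P i) = 0) ∧
      lam * (Qopt.trace.re - Ptot) = 0 := by

  set G := Hᴴ * (1 + H * Qopt * Hᴴ)⁻¹ * H with hG
  have hGherm : G.IsHermitian :=
    ((hfeas.1.posDef_one_add_mul_mul_conjTranspose H).inv.posSemidef.conjTranspose_mul_mul_same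
      H).isHermitian
  obtain ⟨y, hy, hyK, hyc⟩ := exists_multipliers_of_isMaxOn (posSemidefCone (Fin nT))
    (reTraceMul G)
    (fun k : Option (Fin nT) => k.elim (reTraceMul 1) fun i => reTraceMul (Matrix.single i i 1))
    (c := fun k => k.elim Ptot P) (v := (G * Qopt).trace.re)
    (by rintro (_ | i); exacts [hPtot, hP i])
    (fun Q hQ hle => re_trace_gradient_mul_le_of_isMax hfeas hopt
      ⟨hQ, fun i => by simpa [reTraceMul_apply, Matrix.trace_single_mul] using hle (some i),
        by simpa [reTraceMul_apply] using hle none⟩)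
  simp only [Fintype.sum_option, Option.elim] at hyK hyc
  set M := (y none : ℂ) • (1 : Matrix (Fin nT) (Fin nT) ℂ) +
    Matrix.diagonal (fun i => (y (some i) : ℂ)) - G with hM
  have htrM : ∀ Q : Matrix (Fin nT) (Fin nT) ℂ, (M * Q).trace.re =
      y none * Q.trace.re + ∑ i, y (some i) * (Q i i).re - (G * Q).trace.re := fun Q => by
    simp [hM, Matrix.sub_mul, Matrix.add_mul, Matrix.trace, Matrix.diagonal_mul, Finset.mul_sum,
      Finset.sum_add_distrib]
  have hMherm : M.IsHermitian := by
    refine (Matrix.IsHermitian.add ?_ ?_).sub hGherm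
    · simp [Matrix.IsHermitian, Matrix.conjTranspose_smul]
    · exact Matrix.isHermitian_diagonal_of_self_adjoint _ (by ext i; simp)
  have hnn : ∀ Q : Matrix (Fin nT) (Fin nT) ℂ, Q.PosSemidef → 0 ≤ (M * Q).trace.re := fun Q hQ => by
    have := hyK Q hQ
    simp only [reTraceMul_apply, Matrix.trace_single_mul, one_mul, one_smul] at this
    rw [htrM]
    linarith
  have hMpsd : M.PosSemidef := Matrix.posSemidef_of_re_trace_mul_nonneg hMherm hnn
  have hslack : ∀ i, y (some i) * ((Qopt i i).re - P i) ≤ 0 := fun i =>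
    mul_nonpos_of_nonneg_of_nonpos (hy _) (sub_nonpos.2 (hfeas.2.1 i))
  have hslack' : y none * (Qopt.trace.re - Ptot) ≤ 0 :=
    mul_nonpos_of_nonneg_of_nonpos (hy _) (sub_nonpos.2 hfeas.2.2)
  have hsum : ∑ i, y (some i) * ((Qopt i i).re - P i) ≤ 0 := Finset.sum_nonpos fun i _ => hslack i
  have hsplit : ∑ i, y (some i) * ((Qopt i i).re - P i) =
      ∑ i, y (some i) * (Qopt i i).re - ∑ i, y (some i) * P i := by
    simp only [mul_sub, Finset.sum_sub_distrib]
  have htr := htrM Qopt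
  have hnn' := hnn Qopt hfeas.1
  refine ⟨y none, fun i => y (some i), M, hy _, fun i => hy _, hMpsd, by rw [hM]; abel, ?_,
    fun i => ?_, by linarith⟩
  · refine hMpsd.mul_eq_zero_of_trace_mul_eq_zero hfeas.1 (Complex.ext (by
      rw [Complex.zero_re]; linarith) ?_)
    rw [Complex.zero_im, ← Complex.conj_eq_iff_im, starRingEnd_apply, ← Matrix.trace_conjTranspose,
      Matrix.conjTranspose_mul, hMherm.eq, hfeas.1.isHermitian.eq, Matrix.trace_mul_comm]
  · exact (Finset.sum_eq_zero_iff_of_nonpos fun i _ => hslack i).1 (by linarith) i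
      (Finset.mem_univ i)
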